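/- Let 𝕜 be an algebraically closed field, let n ≥ 1, and let F be a homogeneous polynomial of degree d in the n+1 variables x_0,…,x_n over 𝕜 with 1 ≤ d ≤ n. Then for every nonzero point p ∈ 𝕜^{n+1} with F(p) = 0, there exists v ∈ 𝕜^{n+1} that is not a scalar multiple of p such that F(p + t·v) = t^d · F(v) for all t ∈ 𝕜. In other words, through every point of a degree-d hypersurface in ℙⁿ with d ≤ n there is a line meeting the hypersurface to order at least d at that point. -/

import Mathlib

namespace MvPolynomial

/-- Over an algebraically closed field, fewer polynomials than variables never have exactly one
common zero. -/
theorem exists_ne_forall_eval_eq_zero {𝕜 σ : Type*} [Field 𝕜] [IsAlgClosed 𝕜] [Finite σ]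
    (s : Finset (MvPolynomial σ 𝕜)) (hs : s.card < Nat.card σ) (b : σ → 𝕜)
    (hb : ∀ f ∈ s, eval b f = 0) : ∃ x ≠ b, ∀ f ∈ s, eval x f = 0 := by
  classical
  by_contra! hunique
  have hdim : ringKrullDim (MvPolynomial σ 𝕜) ≤ (s.card : ℕ∞) := by
    rw [ringKrullDim_le_iff_isMaximal_height_le]
    intro m hm
    obtain ⟨a, rfl⟩ := isMaximal_iff_eq_vanishingIdeal_singleton.mp hm
    let τ : MvPolynomial σ 𝕜 →ₐ[𝕜] MvPolynomial σ 𝕜 := aeval fun i ↦ X i + C (b i - a i)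
    have hτ (x : σ → 𝕜) (f : MvPolynomial σ 𝕜) : aeval x (τ f) = eval (x + (b - a)) f := by
      rw [← AlgHom.comp_apply, comp_aeval, aeval_eq_eval]
      congr 2
      ext i
      simp
    have hzero : zeroLocus 𝕜 (Ideal.span (s.image τ : Set (MvPolynomial σ 𝕜))) = {a} := by
      ext x
      simp only [zeroLocus_span, Finset.coe_image, Set.forall_mem_image, Finset.mem_coe,
        Set.mem_ofPred_eq, hτ, Set.mem_singleton_iff]
      constructor
      · intro h
        by_contra hxa
        obtain ⟨f, hf, hfx⟩ := hunique (x + (b - a)) fun h ↦ hxa <| by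
          rw [← sub_eq_zero, ← sub_eq_zero.mpr h]; abel
        exact hfx (h hf)
      · rintro rfl f hf
        simpa using hb f hf
    have hmin : vanishingIdeal 𝕜 {a} ∈
        (Ideal.span (s.image τ : Set (MvPolynomial σ 𝕜))).minimalPrimes := by
      rw [← hzero, vanishingIdeal_zeroLocus_eq_radical, ← Ideal.radical_minimalPrimes,
        ← vanishingIdeal_zeroLocus_eq_radical (K := 𝕜), hzero,
        Ideal.minimalPrimes_eq_subsingleton_self]
      exact Set.mem_singleton _
    exact_mod_cast (Ideal.height_le_card_of_mem_minimalPrimes_span_finset hmin).trans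
      (Nat.cast_le.mpr Finset.card_image_le)
  rw [ringKrullDim_of_isNoetherianRing, ringKrullDim_eq_zero_of_field, zero_add] at hdim
  exact hs.not_ge (by exact_mod_cast hdim)

theorem eval_smul_of_isHomogeneous {R σ : Type*} [CommSemiring R] {d : ℕ} {F : MvPolynomial σ R}
    (hF : F.IsHomogeneous d) (s : R) (x : σ → R) : eval (s • x) F = s ^ d * eval x F := by
  rw [eval_eq, eval_eq, Finset.mul_sum]
  refine Finset.sum_congr rfl fun m hm ↦ ?_
  have hdeg : ∑ i ∈ m.support, m i = d := by
    rw [← hF (mem_support_iff.mp hm)]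
    simp [Finsupp.weight_apply, Finsupp.sum]
  simp only [Pi.smul_apply, smul_eq_mul, mul_pow, Finset.prod_mul_distrib,
    Finset.prod_pow_eq_pow_sum, hdeg]
  ring

/-- If the restriction of a homogeneous polynomial of degree `d` to the parametrized line
`t ↦ p + t • v` vanishes to order at least `d` at `t = 0`, it is `t ^ d` times the value at `v`. -/
theorem eval_add_smul_of_isHomogeneous_of_coeff_eq_zero {𝕜 σ : Type*} [Field 𝕜]
    [Infinite 𝕜] {d : ℕ} {F : MvPolynomial σ 𝕜} (hF : F.IsHomogeneous d) (p v : σ → 𝕜)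
    (h : ∀ k < d, (aeval (fun i ↦ Polynomial.C (p i) + Polynomial.X * Polynomial.C (v i)) F).coeff k
      = 0) (t : 𝕜) :
    eval (p + t • v) F = t ^ d * eval v F := by
  have heval (x y : σ → 𝕜) (t : 𝕜) :
      (aeval (fun i ↦ Polynomial.C (x i) + Polynomial.X * Polynomial.C (y i)) F).eval t =
        eval (x + t • y) F := by
    rw [← Polynomial.coe_aeval_eq_eval, ← AlgHom.comp_apply, comp_aeval, aeval_eq_eval]
    congr 2
    ext i
    simp only [Pi.add_apply, Pi.smul_apply, smul_eq_mul, map_add, map_mul, Polynomial.aeval_X,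
      Polynomial.aeval_C, Algebra.algebraMap_self_apply]
  set q := aeval (fun i ↦ Polynomial.C (p i) + Polynomial.X * Polynomial.C (v i)) F with hq
  set r := aeval (fun i ↦ Polynomial.C (v i) + Polynomial.X * Polynomial.C (p i)) F with hr
  have hdeg : q.natDegree ≤ d := by
    simpa using aeval_natDegree_le F hF.totalDegree_le _ (n := 1) fun i ↦ by compute_degree
  have hqd : q = Polynomial.C (q.coeff d) * Polynomial.X ^ d := by
    ext k
    rw [Polynomial.coeff_C_mul_X_pow]
    split_ifs with hk
    · rw [hk]
    · rcases lt_or_gt_of_ne hk with hk | hk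
      · exact h k hk
      · exact Polynomial.coeff_eq_zero_of_natDegree_lt (hdeg.trans_lt hk)
  have hqt (t : 𝕜) : eval (p + t • v) F = q.coeff d * t ^ d := by
    rw [← heval, ← hq, hqd]
    simp
  have hrC : Polynomial.X * (r - Polynomial.C (q.coeff d)) = 0 := by
    refine Polynomial.funext fun s ↦ ?_
    rcases eq_or_ne s 0 with rfl | hs
    · simp
    have hscale : v + s • p = s • (p + s⁻¹ • v) := by
      rw [smul_add, smul_inv_smul₀ hs, add_comm]
    have : eval (v + s • p) F = q.coeff d := by
      rw [hscale, eval_smul_of_isHomogeneous hF, hqt, mul_left_comm, ← mul_pow, mul_inv_cancel₀ hs,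
        one_pow, mul_one]
    rw [Polynomial.eval_mul, Polynomial.eval_sub, heval, this]
    simp
  have hv : eval v F = q.coeff d := by
    have := sub_eq_zero.mp ((mul_eq_zero.mp hrC).resolve_left Polynomial.X_ne_zero)
    simpa only [hr, heval, zero_smul, add_zero, Polynomial.eval_C] using
      congrArg (Polynomial.eval 0) this
  rw [hqt, hv, mul_comm]

end MvPolynomial

/-- Through every point of a degree-`d` hypersurface in ℙⁿ with `1 ≤ d ≤ n`
(over an algebraically closed field) there is a line meeting the hypersurface
to order at least `d` at that point: for every nonzero `p` with `F(p) = 0`,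
there is `v` not a scalar multiple of `p` with `F(p + t·v) = t^d · F(v)` for
all `t`. -/
theorem stmt_8 {𝕜 : Type*} [Field 𝕜] [IsAlgClosed 𝕜] (n d : ℕ) (hn : 1 ≤ n)
    (hd1 : 1 ≤ d) (hdn : d ≤ n)
    (F : MvPolynomial (Fin (n + 1)) 𝕜) (hF : F.IsHomogeneous d)
    (p : Fin (n + 1) → 𝕜) (hp : p ≠ 0) (hFp : MvPolynomial.eval p F = 0) :
    ∃ v : Fin (n + 1) → 𝕜, (¬ ∃ c : 𝕜, v = c • p) ∧
      ∀ t : 𝕜, MvPolynomial.eval (p + t • v) F = t ^ d * MvPolynomial.eval v F := by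
  classical
  obtain ⟨i, hi⟩ := Function.ne_iff.mp hp
  let Q : Polynomial (MvPolynomial (Fin (n + 1)) 𝕜) := MvPolynomial.aeval (fun j ↦
    Polynomial.C (MvPolynomial.C (p j)) + Polynomial.X * Polynomial.C (MvPolynomial.X j)) F
  have hQ (v : Fin (n + 1) → 𝕜) : Q.map (MvPolynomial.eval v) = MvPolynomial.aeval
      (fun j ↦ Polynomial.C (p j) + Polynomial.X * Polynomial.C (v j)) F := by
    simp only [Q, MvPolynomial.aeval_def, ← Polynomial.coe_mapRingHom, MvPolynomial.hom_eval₂]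
    congr 1
    · ext; simp
    · ext; simp
  have hcoeff (v : Fin (n + 1) → 𝕜) (k : ℕ) : MvPolynomial.eval v (Q.coeff k) =
      (MvPolynomial.aeval
        (fun j ↦ Polynomial.C (p j) + Polynomial.X * Polynomial.C (v j)) F).coeff k := by
    rw [← hQ, Polynomial.coeff_map]
  obtain ⟨v, hv0, hv⟩ := MvPolynomial.exists_ne_forall_eval_eq_zero
    (insert (MvPolynomial.X i) ((Finset.Ico 1 d).image Q.coeff))
    (by
      have h₁ := Finset.card_insert_le (MvPolynomial.X i) ((Finset.Ico 1 d).image Q.coeff)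
      have h₂ := Finset.card_image_le (s := Finset.Ico 1 d) (f := Q.coeff)
      rw [Nat.card_Ico] at h₂
      rw [Nat.card_fin]
      lia) 0
    (by
      simp only [Finset.forall_mem_insert, Finset.forall_mem_image, Finset.mem_Ico]
      refine ⟨by simp, fun k hk ↦ ?_⟩
      have hC : (fun j ↦ Polynomial.C (p j) + Polynomial.X * Polynomial.C 0) =
          algebraMap 𝕜 (Polynomial 𝕜) ∘ p := by
        ext; simp
      simp only [hcoeff, Pi.zero_apply, hC]
      rw [MvPolynomial.aeval_algebraMap_apply, Polynomial.algebraMap_eq,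
        Polynomial.coeff_C_of_ne_zero (by lia)])
  simp only [Finset.forall_mem_insert, Finset.forall_mem_image, Finset.mem_Ico,
    MvPolynomial.eval_X] at hv
  refine ⟨v, ?_,
    MvPolynomial.eval_add_smul_of_isHomogeneous_of_coeff_eq_zero hF p v fun k hk ↦ ?_⟩
  · rintro ⟨c, rfl⟩
    have hc : c = 0 := (mul_eq_zero.mp hv.1).resolve_right hi
    exact hv0 (by rw [hc, zero_smul])
  · rcases Nat.eq_zero_or_pos k with rfl | hk0
    · rw [Polynomial.coeff_zero_eq_eval_zero, ← Polynomial.coe_aeval_eq_eval,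
        ← AlgHom.comp_apply, MvPolynomial.comp_aeval, MvPolynomial.aeval_eq_eval]
      simpa using hFp
    · rw [← hcoeff]
      exact hv.2 ⟨hk0, hk⟩
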